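/- Let (X_n)_{n≥0} and (A_n)_{n≥1} be sequences of nonnegative random variables with X_0 ≡ 0 such that for every n ≥ 1 the following stochastic domination holds: P(X_n ≥ x) ≤ P((1/√2)·max{X̂_{I_n}, X̂'_{n−1−I_n}} + Â_n ≥ x) for all x ∈ ℝ, where, on some probability space, (X̂_m)_{m≥0}, (X̂'_m)_{m≥0} and I_n are independent, (X̂_m) and (X̂'_m) each have the same joint distribution as (X_m), I_n is uniform on {0,…,n−1}, and Â_n is a nonnegative random variable with the same distribution as A_n. If there exist constants κ > 0 and C < ∞ with P(A_n ≥ x) ≤ C·exp(−κx) for all x ≥ 0 and all n ≥ 1, then there exist constants κ̃ > 0 and C̃ < ∞ with P(X_n ≥ x) ≤ C̃·exp(−κ̃x) for all x ≥ 0 and all n ≥ 0. -/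

import Mathlib

open MeasureTheory ProbabilityTheory Real Filter Topology

noncomputable section

/-- the uniform distribution on `{0, 1, …, n−1}`, as a measure on `ℕ` -/
def unifFin (n : ℕ) : Measure ℕ :=
  ((n : ENNReal))⁻¹ • ∑ m ∈ Finset.range n, (Measure.dirac m)

lemma unifFin_univ_aux (n : ℕ) (hn : 1 ≤ n) : unifFin n Set.univ = 1 := by
  simp only [unifFin, Measure.smul_apply, Measure.finsetSum_apply, measure_univ,
    Finset.sum_const, Finset.card_range, smul_eq_mul, nsmul_eq_mul, mul_one]
  exact ENNReal.inv_mul_cancel (by exact_mod_cast (by omega : n ≠ 0)) (by simp)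

lemma unifFin_singleton_aux (n i : ℕ) (hi : n ≤ i) : unifFin n {i} = 0 := by
  simp only [unifFin, Measure.smul_apply, Measure.finsetSum_apply, smul_eq_mul]
  rw [Finset.sum_eq_zero, mul_zero]
  intro m hm
  have : m ≠ i := by have := Finset.mem_range.1 hm; omega
  simp [this]

/-- If each fibre over `i < n` of a set has `ν`-measure at most `B`, mixing over `i` keeps `B`. -/
lemma mix_sum_aux (n : ℕ) (hn : 1 ≤ n) (a : ℕ → ENNReal) (B : ENNReal)
    (ha : ∀ i < n, a i ≤ B) : ∑' i, a i * unifFin n {i} ≤ B := by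
  have h1 : ∀ i, a i * unifFin n {i} ≤ B * unifFin n {i} := by
    intro i
    by_cases hi : i < n
    · gcongr
      exact ha i hi
    · simp [unifFin_singleton_aux n i (not_lt.1 hi)]
  have h2 : ∑' i, unifFin n {i} = 1 := by
    have h := measure_iUnion (μ := unifFin n) (f := fun i : ℕ => ({i} : Set ℕ))
      (by
        intro i j hij
        simpa [Function.onFun] using hij)
      (fun i => measurableSet_singleton i)
    rw [← h, Set.iUnion_of_singleton, unifFin_univ_aux n hn]
  calc ∑' i, a i * unifFin n {i} ≤ ∑' i, B * unifFin n {i} := ENNReal.tsum_le_tsum h1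
    _ = B := by rw [ENNReal.tsum_mul_left, h2, mul_one]

lemma mix_bound_aux (ν : Measure (ℕ → ℝ)) [IsProbabilityMeasure ν] (n : ℕ) (hn : 1 ≤ n)
    (y : ℝ) (B : ENNReal) (hB : ∀ i < n, ν {f | y ≤ f i} ≤ B) :
    ν.prod (ν.prod (unifFin n)) {p | y ≤ p.1 p.2.2} ≤ B ∧
    ν.prod (ν.prod (unifFin n)) {p | y ≤ p.2.1 (n - 1 - p.2.2)} ≤ B := by
  haveI : IsProbabilityMeasure (unifFin n) := ⟨unifFin_univ_aux n hn⟩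
  constructor
  · have hsub : {p : (ℕ → ℝ) × (ℕ → ℝ) × ℕ | y ≤ p.1 p.2.2} ⊆
        ⋃ i : ℕ, {f : ℕ → ℝ | y ≤ f i} ×ˢ ((Set.univ : Set (ℕ → ℝ)) ×ˢ ({i} : Set ℕ)) := by
      rintro ⟨f, g, i⟩ h
      exact Set.mem_iUnion.2 ⟨i, h, trivial, rfl⟩
    refine (measure_mono hsub).trans ((measure_iUnion_le _).trans ?_)
    simp only [Measure.prod_prod, measure_univ, one_mul]
    exact mix_sum_aux n hn _ B hB
  · have hsub : {p : (ℕ → ℝ) × (ℕ → ℝ) × ℕ | y ≤ p.2.1 (n - 1 - p.2.2)} ⊆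
        ⋃ i : ℕ, (Set.univ : Set (ℕ → ℝ)) ×ˢ ({f : ℕ → ℝ | y ≤ f (n - 1 - i)} ×ˢ ({i} : Set ℕ)) := by
      rintro ⟨f, g, i⟩ h
      exact Set.mem_iUnion.2 ⟨i, trivial, h, rfl⟩
    refine (measure_mono hsub).trans ((measure_iUnion_le _).trans ?_)
    simp only [Measure.prod_prod, measure_univ, one_mul]
    exact mix_sum_aux n hn (fun i => ν {f | y ≤ f (n - 1 - i)}) B
      (fun i hi => hB _ (by omega))

lemma real_bound_aux (c K C x : ℝ) (hc : 0 < c) (hx0 : 0 ≤ x) (hx : 4 * Real.log 4 / c ≤ x)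
    (hK : 1 ≤ K) (hKC : 2 * C ≤ K) :
    C * Real.exp (-(20 * c) * (x / 10)) + (K * Real.exp (-c * (5 / 4 * x))
      + K * Real.exp (-c * (5 / 4 * x))) ≤ K * Real.exp (-c * x) := by
  have h4 : Real.exp (-c * (5 / 4 * x)) ≤ Real.exp (-c * x) * (1 / 4) := by
    have : (1 / 4 : ℝ) = Real.exp (-Real.log 4) := by
      rw [Real.exp_neg, Real.exp_log (by norm_num)]; norm_num
    rw [this, ← Real.exp_add, Real.exp_le_exp]
    rw [div_le_iff₀ hc] at hx
    nlinarith
  have h2 : Real.exp (-(20 * c) * (x / 10)) ≤ Real.exp (-c * x) := by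
    rw [Real.exp_le_exp]
    nlinarith [mul_nonneg hc.le hx0]
  have hp := Real.exp_pos (-c * x)
  have hq := Real.exp_pos (-(20 * c) * (x / 10))
  nlinarith [mul_le_mul_of_nonneg_left h4 (by linarith : (0:ℝ) ≤ K),
    mul_le_mul_of_nonneg_right hKC hq.le, mul_le_mul_of_nonneg_left h2 (by linarith : (0:ℝ) ≤ K)]

/-- **Lemma 5**: if `(X_n)` satisfies the stochastic recursive domination
`X_n ≤_D max(X̂_{I_n}, X̂'_{n−1−I_n})/√2 + Â_n`, where `(X̂_m)`, `(X̂'_m)`, `I_n` are independent,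
`(X̂_m)` and `(X̂'_m)` are copies of `(X_m)`, `I_n` is uniform on `{0,…,n−1}` and `Â_n` is
distributed as `A_n`, and if `(A_n)` has uniformly exponentially decreasing tails, then so does
`(X_n)`. -/
theorem uniform_exponential_tails_of_recursive_domination
    {Ω : Type} [MeasurableSpace Ω] (P : Measure Ω) [IsProbabilityMeasure P]
    (X : ℕ → Ω → ℝ) (A : ℕ → Ω → ℝ)
    (hXmeas : ∀ n, Measurable (X n)) (hAmeas : ∀ n, Measurable (A n))
    (hXnn : ∀ n ω, 0 ≤ X n ω) (hAnn : ∀ n ω, 0 ≤ A n ω)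
    (hX0 : ∀ ω, X 0 ω = 0)
    (hrec : ∀ n : ℕ, 1 ≤ n →
      ∃ (Ω' : Type) (_ : MeasurableSpace Ω') (P' : Measure Ω'),
        IsProbabilityMeasure P' ∧
        ∃ (Xh Xh' : ℕ → Ω' → ℝ) (In : Ω' → ℕ) (Ah : Ω' → ℝ),
          (∀ m, Measurable (Xh m)) ∧ (∀ m, Measurable (Xh' m)) ∧
          Measurable In ∧ Measurable Ah ∧ (∀ ω', 0 ≤ Ah ω') ∧
          -- `(X̂_m)`, `(X̂'_m)` and `I_n` are independent and the two sequences have the same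
          -- joint distribution as `(X_m)`, while `I_n` is uniform on `{0,…,n−1}`:
          Measure.map (fun ω' => ((fun m => Xh m ω'), (fun m => Xh' m ω'), In ω')) P' =
            ((Measure.map (fun ω => fun m => X m ω) P).prod
              (((Measure.map (fun ω => fun m => X m ω) P)).prod (unifFin n))) ∧
          -- `Â_n` has the same distribution as `A_n`:
          Measure.map Ah P' = Measure.map (A n) P ∧
          -- the stochastic domination `X_n ≤_D max(X̂_{I_n}, X̂'_{n−1−I_n})/√2 + Â_n`:
          (∀ x : ℝ, P {ω | x ≤ X n ω} ≤
            P' {ω' | x ≤ (Real.sqrt 2)⁻¹ * max (Xh (In ω') ω') (Xh' (n - 1 - In ω') ω') + Ah ω'}))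
    (κ C : ℝ) (hκ : 0 < κ)
    (hA : ∀ n : ℕ, 1 ≤ n → ∀ x : ℝ, 0 ≤ x →
      P {ω | x ≤ A n ω} ≤ ENNReal.ofReal (C * Real.exp (-κ * x))) :
    ∃ κ' C' : ℝ, 0 < κ' ∧
      ∀ n : ℕ, ∀ x : ℝ, 0 ≤ x →
        P {ω | x ≤ X n ω} ≤ ENNReal.ofReal (C' * Real.exp (-κ' * x)) := by
  set c : ℝ := κ / 20 with hcdef
  have hc : 0 < c := by positivity
  have hκc : κ = 20 * c := by rw [hcdef]; ring
  set x₀ : ℝ := 4 * Real.log 4 / c with hx₀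
  have hx₀pos : 0 < x₀ := by
    have : 0 < Real.log 4 := Real.log_pos (by norm_num)
    positivity
  set K : ℝ := max (Real.exp (c * x₀)) (2 * C) with hKdef
  have hK1 : Real.exp (c * x₀) ≤ K := le_max_left _ _
  have hKC : 2 * C ≤ K := le_max_right _ _
  have hK : 1 ≤ K := (Real.one_le_exp (by positivity)).trans hK1
  refine ⟨c, K, hc, ?_⟩
  intro n
  induction n using Nat.strong_induction_on with
  | _ n ih =>
  intro x hx
  by_cases hxx : x ≤ x₀
  · refine prob_le_one.trans ?_
    rw [ENNReal.one_le_ofReal]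
    calc (1 : ℝ) ≤ Real.exp (c * x₀) * Real.exp (-c * x) := by
          rw [← Real.exp_add]
          exact Real.one_le_exp (by nlinarith)
      _ ≤ K * Real.exp (-c * x) := by gcongr
  push Not at hxx
  rcases Nat.eq_zero_or_pos n with rfl | hn
  · have : {ω | x ≤ X 0 ω} = ∅ := by
      ext ω
      simp only [hX0, Set.mem_setOf_eq, Set.mem_empty_iff_false, iff_false, not_le]
      linarith
    rw [this]
    simp
  obtain ⟨Ω', _, P', hP', Xh, Xh', In, Ah, hXh, hXh', hIn, hAh, hAh0, hmap, hmapA, hdom⟩ :=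
    hrec n hn
  have hXm : Measurable (fun ω => fun m => X m ω) := measurable_pi_iff.2 hXmeas
  have hJ : Measurable (fun ω' => ((fun m => Xh m ω'), (fun m => Xh' m ω'), In ω')) :=
    (measurable_pi_iff.2 hXh).prodMk ((measurable_pi_iff.2 hXh').prodMk hIn)
  haveI : IsProbabilityMeasure (Measure.map (fun ω => fun m => X m ω) P) :=
    Measure.isProbabilityMeasure_map hXm.aemeasurable
  have hmix := mix_bound_aux (Measure.map (fun ω => fun m => X m ω) P) n hn (5 / 4 * x)
    (ENNReal.ofReal (K * Real.exp (-c * (5 / 4 * x)))) (by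
      intro i hi
      rw [Measure.map_apply hXm (measurableSet_le measurable_const (measurable_pi_apply i))]
      exact ih i hi _ (by positivity))
  rw [← hmap] at hmix
  have h1 := (Measure.le_map_apply hJ.aemeasurable _).trans hmix.1
  have h2 := (Measure.le_map_apply hJ.aemeasurable _).trans hmix.2
  have h3 : P' {ω' | x / 10 ≤ Ah ω'} ≤ ENNReal.ofReal (C * Real.exp (-κ * (x / 10))) := by
    have hm : MeasurableSet {t : ℝ | x / 10 ≤ t} := measurableSet_Ici
    have e := congrArg (fun μ => μ {t : ℝ | x / 10 ≤ t}) hmapA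
    simp only [Measure.map_apply hAh hm, Measure.map_apply (hAmeas n) hm] at e
    exact e.le.trans (hA n hn _ (by positivity))
  have hsub : {ω' | x ≤ (Real.sqrt 2)⁻¹ * max (Xh (In ω') ω') (Xh' (n - 1 - In ω') ω') + Ah ω'} ⊆
      {ω' | x / 10 ≤ Ah ω'} ∪ ({ω' | 5 / 4 * x ≤ Xh (In ω') ω'} ∪
        {ω' | 5 / 4 * x ≤ Xh' (n - 1 - In ω') ω'}) := by
    intro ω' h
    simp only [Set.mem_setOf_eq, Set.mem_union] at h ⊢
    by_contra hcon
    push Not at hcon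
    obtain ⟨ha, hb, hd⟩ := hcon
    have hmax := max_lt hb hd
    have hs : (Real.sqrt 2)⁻¹ ≤ 18 / 25 := by
      rw [inv_le_comm₀ (by positivity) (by norm_num)]
      exact Real.le_sqrt_of_sq_le (by norm_num)
    have hs0 : 0 < (Real.sqrt 2)⁻¹ := by positivity
    nlinarith [mul_lt_mul_of_pos_left hmax hs0, mul_le_mul_of_nonneg_right hs hx]
  have hKe : 0 ≤ K * Real.exp (-c * (5 / 4 * x)) := by positivity
  have hfin := real_bound_aux c K C x hc hx hxx.le hK hKC
  rw [hκc] at h3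
  by_cases hC : 0 ≤ C
  · calc P {ω | x ≤ X n ω} ≤ _ := hdom x
      _ ≤ _ := measure_mono hsub
      _ ≤ _ := (measure_union_le _ _).trans
        (add_le_add h3 ((measure_union_le _ _).trans (add_le_add h1 h2)))
      _ ≤ _ := by
        rw [← ENNReal.ofReal_add hKe hKe, ← ENNReal.ofReal_add (by positivity) (by positivity)]
        exact ENNReal.ofReal_le_ofReal hfin
  · exfalso
    have h := hA n hn 0 le_rfl
    have hu : {ω | 0 ≤ A n ω} = Set.univ := by
      ext ω
      simp [hAnn n ω]
    rw [hu, measure_univ, ENNReal.one_le_ofReal] at h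
    simp at h
    linarith


end
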